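/- Almost everywhere summability: for every κ > 0, let φ₀ : [0,∞) → ℝ be differentiable with φ₀(r) → 0 as r → ∞ and ∫_0^∞ r^{2κ+1} |φ₀'(r)| dr < ∞, set φ(x) = φ₀(|x|), and assume φ ∈ L¹(μ_κ) with ∫_ℝ φ dμ_κ = 1. Then for every f ∈ L¹(μ_κ), (f *_κ φ_ε)(x) → f(x) as ε → 0⁺ for almost every x ∈ ℝ. -/

import Mathlib

open MeasureTheory Real Filter Topology

/-- The weighted measure `dμ_κ(t) = |t|^{2κ} dt` on `ℝ`. -/
noncomputable def mu (κ : ℝ) : Measure ℝ :=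
  MeasureTheory.volume.withDensity (fun t => ENNReal.ofReal (|t| ^ (2 * κ)))

/-- The normalizing constant `b_κ = Γ(κ+1/2)/(√π Γ(κ))`. -/
noncomputable def bk (κ : ℝ) : ℝ := Real.Gamma (κ + 1 / 2) / (Real.sqrt π * Real.Gamma κ)

/-- The density `Φ_κ(u) = b_κ (1+u)(1-u²)^{κ-1}`. -/
noncomputable def Phi (κ u : ℝ) : ℝ := bk κ * (1 + u) * (1 - u ^ 2) ^ (κ - 1)

/-- The generalized (Dunkl) translation operator `τ_s` for the group `ℤ₂` on `ℝ`. -/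
noncomputable def tau (κ s : ℝ) (f : ℝ → ℂ) (t : ℝ) : ℂ :=
  (1 / 2 : ℂ) * ∫ u in Set.Ioo (-1 : ℝ) 1,
    (f (Real.sqrt (t ^ 2 + s ^ 2 - 2 * s * t * u)) *
        ((1 + (t - s) / Real.sqrt (t ^ 2 + s ^ 2 - 2 * s * t * u) : ℝ) : ℂ) +
      f (-Real.sqrt (t ^ 2 + s ^ 2 - 2 * s * t * u)) *
        ((1 - (t - s) / Real.sqrt (t ^ 2 + s ^ 2 - 2 * s * t * u) : ℝ) : ℂ)) *
    ((Phi κ u : ℝ) : ℂ)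

/-- The generalized convolution `(f *_κ g)(x) = ∫ f(y) τ_x g^∨(y) dμ_κ(y)`. -/
noncomputable def conv (κ : ℝ) (f g : ℝ → ℂ) (x : ℝ) : ℂ :=
  ∫ y, f y * tau κ x (fun z => g (-z)) y ∂(mu κ)

/-- The dilation `φ_ε(x) = ε^{-(2κ+1)} φ(x/ε)`. -/
noncomputable def dil (κ : ℝ) (φ : ℝ → ℂ) (ε x : ℝ) : ℂ :=
  ((ε ^ (-(2 * κ + 1)) : ℝ) : ℂ) * φ (x / ε)

/-- The Hardy–Littlewood type maximal function for the Dunkl convolution. -/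
noncomputable def maximal (κ : ℝ) (f : ℝ → ℂ) (x : ℝ) : ℝ :=
  ⨆ r : {r : ℝ // 0 < r},
    ‖conv κ f (Set.indicator (Set.Icc (-(r : ℝ)) (r : ℝ)) (fun _ => (1 : ℂ))) x‖ /
      (mu κ (Set.Icc (-(r : ℝ)) (r : ℝ))).toReal


theorem integrableOn_deriv_Ioi_and_integral_eq {φ₀ : ℝ → ℝ} {d : ℝ} (hd : 0 < d)
    (hdiff : DifferentiableOn ℝ φ₀ (Set.Ici 0)) (hlim : Tendsto φ₀ atTop (nhds 0))
    (hint : IntegrableOn (fun r => r ^ d * |deriv φ₀ r|) (Set.Ioi 0)) {r : ℝ} (hr : 0 < r) :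
    IntegrableOn (deriv φ₀) (Set.Ioi r) ∧ ∫ s in Set.Ioi r, deriv φ₀ s = -φ₀ r := by
  have hda : ∀ s, 0 < s → HasDerivAt φ₀ (deriv φ₀ s) s := fun s hs =>
    (hdiff.differentiableAt (Ici_mem_nhds hs)).hasDerivAt
  have hi : IntegrableOn (deriv φ₀) (Set.Ioi r) := by
    have h1 : IntegrableOn (fun s => (r ^ d)⁻¹ * (s ^ d * |deriv φ₀ s|)) (Set.Ioi r) :=
      (hint.mono_set (Set.Ioi_subset_Ioi hr.le)).const_mul _
    refine h1.mono' (measurable_deriv φ₀).aestronglyMeasurable ?_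
    filter_upwards [ae_restrict_mem measurableSet_Ioi] with s hs
    have hs' : r < s := hs
    have h2 : r ^ d ≤ s ^ d := Real.rpow_le_rpow hr.le hs'.le hd.le
    have h3 : 0 < r ^ d := Real.rpow_pos_of_pos hr d
    rw [Real.norm_eq_abs, ← mul_assoc]
    refine le_mul_of_one_le_left (abs_nonneg _) ?_
    rw [inv_mul_eq_div, one_le_div h3]
    exact h2
  refine ⟨hi, ?_⟩
  rw [integral_Ioi_of_hasDerivAt_of_tendsto (hda r hr).continuousAt.continuousWithinAt
    (fun s hs => hda s (hr.trans hs)) hi hlim, zero_sub]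

/-- A radial integral expressed through the integrals over sublevel sets of the radius. -/
theorem integral_mul_radial_eq {α : Type*} [MeasurableSpace α] {P : Measure α} [SFinite P]
    {F : α → ℂ} (hF : AEStronglyMeasurable F P) {ρ : α → ℝ} (hρ : Measurable ρ)
    (hpos : ∀ᵐ a ∂P, 0 < ρ a) {φ₀ : ℝ → ℝ} {d : ℝ} (hd : 0 < d)
    (hdiff : DifferentiableOn ℝ φ₀ (Set.Ici 0)) (hlim : Tendsto φ₀ atTop (nhds 0))
    (hint : IntegrableOn (fun r => r ^ d * |deriv φ₀ r|) (Set.Ioi 0)) {M : ℝ}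
    (hM : ∀ r, 0 < r → ∫⁻ a in {a | ρ a < r}, ‖F a‖ₑ ∂P ≤ ENNReal.ofReal (M * r ^ d)) :
    Integrable (fun a => F a * (φ₀ (ρ a) : ℂ)) P ∧
    AEStronglyMeasurable (fun s : ℝ => ((deriv φ₀ s : ℝ) : ℂ) * ∫ a in {a | ρ a < s}, F a ∂P)
      (volume.restrict (Set.Ioi 0)) ∧
    ∫ a, F a * (φ₀ (ρ a) : ℂ) ∂P =
      -∫ s : ℝ in Set.Ioi 0, ((deriv φ₀ s : ℝ) : ℂ) * ∫ a in {a | ρ a < s}, F a ∂P := by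
  set K : α → ℝ → ℂ := fun a s => ({a | ρ a < s} : Set α).indicator
    (fun a => F a * ((deriv φ₀ s : ℝ) : ℂ)) a with hK
  have hmeas : MeasurableSet {p : α × ℝ | ρ p.1 < p.2} :=
    measurableSet_lt (hρ.comp measurable_fst) measurable_snd
  have hKu : Function.uncurry K = {p : α × ℝ | ρ p.1 < p.2}.indicator
      (fun p => F p.1 * ((deriv φ₀ p.2 : ℝ) : ℂ)) := by
    ext p; simp [hK, Function.uncurry, Set.indicator]
  have hset : ∀ s, MeasurableSet {a | ρ a < s} := fun s => measurableSet_lt hρ measurable_const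
  have hKm : AEStronglyMeasurable (Function.uncurry K) (P.prod (volume.restrict (Set.Ioi 0))) := by
    rw [hKu]
    refine AEStronglyMeasurable.indicator (hF.comp_fst.mul ?_) hmeas
    exact (Complex.measurable_ofReal.comp
      ((measurable_deriv φ₀).comp measurable_snd)).aestronglyMeasurable
  have hKs : ∀ s, ∫ a, K a s ∂P = ((deriv φ₀ s : ℝ) : ℂ) * ∫ a in {a | ρ a < s}, F a ∂P := by
    intro s
    simp only [hK]
    rw [integral_indicator (hset s), integral_mul_const, mul_comm]
  have hKi : Integrable (Function.uncurry K) (P.prod (volume.restrict (Set.Ioi 0))) := by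
    refine ⟨hKm, ?_⟩
    rw [hasFiniteIntegral_iff_enorm, lintegral_prod_symm _ hKm.enorm]
    have hb : ∀ᵐ s ∂(volume.restrict (Set.Ioi (0 : ℝ))), ∫⁻ a, ‖Function.uncurry K (a, s)‖ₑ ∂P ≤
        ENNReal.ofReal M * ‖s ^ d * |deriv φ₀ s|‖ₑ := by
      filter_upwards [ae_restrict_mem measurableSet_Ioi] with s hs
      have hs' : (0 : ℝ) < s := hs
      have h1 : ∀ a, ‖Function.uncurry K (a, s)‖ₑ =
          ({a | ρ a < s} : Set α).indicator (fun a => ‖F a‖ₑ * ‖((deriv φ₀ s : ℝ) : ℂ)‖ₑ) a := by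
        intro a
        simp only [hK, Function.uncurry]
        rw [enorm_indicator_eq_indicator_enorm]
        simp [Set.indicator, enorm_mul]
      simp_rw [h1]
      rw [lintegral_indicator (hset s), lintegral_mul_const' _ _ (by simp)]
      have h2 : ENNReal.ofReal M * ‖s ^ d * |deriv φ₀ s|‖ₑ =
          ENNReal.ofReal (M * s ^ d) * ‖((deriv φ₀ s : ℝ) : ℂ)‖ₑ := by
        have h3 : 0 < s ^ d := Real.rpow_pos_of_pos hs' d
        have h4 : ‖((deriv φ₀ s : ℝ) : ℂ)‖ₑ = ENNReal.ofReal |deriv φ₀ s| := by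
          rw [← ofReal_norm, Complex.norm_real, Real.norm_eq_abs]
        rw [h4, ENNReal.ofReal_mul' h3.le, mul_assoc, ← ENNReal.ofReal_mul h3.le,
          Real.enorm_of_nonneg (by positivity)]
      rw [h2]
      exact mul_le_mul_left (hM s hs') _
    refine (lintegral_mono_ae hb).trans_lt ?_
    rw [lintegral_const_mul' _ _ ENNReal.ofReal_ne_top]
    exact ENNReal.mul_lt_top ENNReal.ofReal_lt_top hint.2
  have hKa : ∀ᵐ a ∂P, ∫ s : ℝ in Set.Ioi 0, K a s = -(F a * (φ₀ (ρ a) : ℂ)) := by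
    filter_upwards [hpos] with a ha
    have h1 : (fun s => K a s) = (Set.Ioi (ρ a)).indicator (fun s => F a * ((deriv φ₀ s : ℝ) : ℂ)) := by
      ext s; simp [hK, Set.indicator]
    rw [h1, setIntegral_indicator measurableSet_Ioi,
      Set.inter_eq_self_of_subset_right (Set.Ioi_subset_Ioi ha.le), integral_const_mul,
      integral_complex_ofReal,
      (integrableOn_deriv_Ioi_and_integral_eq hd hdiff hlim hint ha).2]
    push_cast; ring
  refine ⟨?_, ?_, ?_⟩
  · refine (hKi.integral_prod_left.neg).congr ?_
    filter_upwards [hKa] with a ha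
    simp only [Pi.neg_apply, Function.uncurry]
    rw [ha, neg_neg]
  · simp_rw [← hKs]
    exact hKi.integral_prod_right.1
  · simp_rw [← hKs]
    rw [← integral_integral_swap hKi, ← integral_neg]
    refine integral_congr_ae ?_
    filter_upwards [hKa] with a ha
    rw [ha, neg_neg]

/-- Convergence of dilated radial averages from the behaviour of small sublevel sets. -/
theorem tendsto_integral_dilated_radial {α : Type*} [MeasurableSpace α] {P : Measure α} [SFinite P]
    {F : α → ℂ} (hF : AEStronglyMeasurable F P) {ρ : α → ℝ} (hρ : Measurable ρ)
    (hpos : ∀ᵐ a ∂P, 0 < ρ a) {φ₀ : ℝ → ℝ} {d : ℝ} (hd : 0 < d)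
    (hdiff : DifferentiableOn ℝ φ₀ (Set.Ici 0)) (hlim : Tendsto φ₀ atTop (nhds 0))
    (hint : IntegrableOn (fun r => r ^ d * |deriv φ₀ r|) (Set.Ioi 0)) {M : ℝ}
    (hM : ∀ r, 0 < r → ∫⁻ a in {a | ρ a < r}, ‖F a‖ₑ ∂P ≤ ENNReal.ofReal (M * r ^ d)) {L : ℂ}
    (hL : Tendsto (fun r : ℝ => ((r ^ (-d) : ℝ) : ℂ) * ∫ a in {a | ρ a < r}, F a ∂P)
      (𝓝[>] 0) (𝓝 L)) :
    (∀ ε, 0 < ε → Integrable (fun a => F a * (φ₀ (ρ a / ε) : ℂ)) P) ∧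
    Tendsto (fun ε : ℝ => ((ε ^ (-d) : ℝ) : ℂ) * ∫ a, F a * (φ₀ (ρ a / ε) : ℂ) ∂P)
      (𝓝[>] 0) (𝓝 (L * -((∫ s : ℝ in Set.Ioi 0, s ^ d * deriv φ₀ s : ℝ) : ℂ))) := by
  have hset : ∀ ε, 0 < ε → ∀ s, {a | ρ a / ε < s} = {a | ρ a < ε * s} := by
    intro ε hε s; ext a; simp [div_lt_iff₀ hε, mul_comm]
  have key := fun ε (hε : 0 < ε) => integral_mul_radial_eq (M := M * ε ^ d) hF
    (hρ.div_const ε) (hpos.mono fun a ha => div_pos ha hε) hd hdiff hlim hint (by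
      intro r hr
      rw [hset ε hε r]
      refine (hM _ (mul_pos hε hr)).trans (le_of_eq ?_)
      rw [Real.mul_rpow hε.le hr.le, mul_assoc])
  refine ⟨fun ε hε => (key ε hε).1, ?_⟩
  have hMn : ∀ r, 0 < r → ‖∫ a in {a | ρ a < r}, F a ∂P‖ ≤ |M| * r ^ d := by
    intro r hr
    have h0 : 0 ≤ |M| * r ^ d := mul_nonneg (abs_nonneg _) (Real.rpow_nonneg hr.le d)
    have h1 : ‖∫ a in {a | ρ a < r}, F a ∂P‖ₑ ≤ ENNReal.ofReal (|M| * r ^ d) :=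
      (enorm_integral_le_lintegral_enorm _).trans ((hM r hr).trans (ENNReal.ofReal_le_ofReal
        (mul_le_mul_of_nonneg_right (le_abs_self M) (Real.rpow_nonneg hr.le d))))
    rw [← ofReal_norm] at h1
    exact (ENNReal.ofReal_le_ofReal_iff h0).1 h1
  have hlimint : Tendsto (fun ε : ℝ => ∫ s : ℝ in Set.Ioi 0, ((ε ^ (-d) : ℝ) : ℂ) *
      (((deriv φ₀ s : ℝ) : ℂ) * ∫ a in {a | ρ a / ε < s}, F a ∂P)) (𝓝[>] 0)
      (𝓝 (∫ s : ℝ in Set.Ioi 0, ((s ^ d * deriv φ₀ s : ℝ) : ℂ) * L)) := by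
    refine tendsto_integral_filter_of_dominated_convergence
      (fun s => |M| * (s ^ d * |deriv φ₀ s|)) ?_ ?_ (hint.const_mul _) ?_
    · filter_upwards [self_mem_nhdsWithin] with ε hε
      exact (key ε hε).2.1.const_mul _
    · filter_upwards [self_mem_nhdsWithin] with ε hε
      have hε' : 0 < ε := hε
      filter_upwards [ae_restrict_mem measurableSet_Ioi] with s hs
      have hs' : 0 < s := hs
      rw [hset ε hε, norm_mul, norm_mul, Complex.norm_real, Complex.norm_real, Real.norm_eq_abs,
        Real.norm_eq_abs, abs_of_nonneg (Real.rpow_nonneg hε'.le _)]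
      have h1 := hMn _ (mul_pos hε' hs')
      rw [Real.mul_rpow hε'.le hs'.le] at h1
      have h2 : ε ^ (-d) * ε ^ d = 1 := by
        rw [← Real.rpow_add hε']; simp
      calc ε ^ (-d) * (|deriv φ₀ s| * ‖∫ a in {a | ρ a < ε * s}, F a ∂P‖)
          ≤ ε ^ (-d) * (|deriv φ₀ s| * (|M| * (ε ^ d * s ^ d))) := by gcongr
        _ = (ε ^ (-d) * ε ^ d) * (|M| * (s ^ d * |deriv φ₀ s|)) := by ring
        _ = _ := by rw [h2, one_mul]
    · filter_upwards [ae_restrict_mem measurableSet_Ioi] with s hs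
      have hs' : 0 < s := hs
      have hmap : Tendsto (fun ε : ℝ => ε * s) (𝓝[>] 0) (𝓝[>] 0) := by
        refine tendsto_nhdsWithin_iff.2 ⟨?_, ?_⟩
        · have : Tendsto (fun ε : ℝ => ε * s) (𝓝 0) (𝓝 (0 * s)) := tendsto_id.mul_const s
          rw [zero_mul] at this
          exact this.mono_left nhdsWithin_le_nhds
        · filter_upwards [self_mem_nhdsWithin] with ε hε
          exact mul_pos hε hs'
      refine ((hL.comp hmap).const_mul ((s ^ d * deriv φ₀ s : ℝ) : ℂ)).congr' ?_
      filter_upwards [self_mem_nhdsWithin] with ε hε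
      have hε' : 0 < ε := hε
      simp only [Function.comp]
      rw [hset ε hε, Real.mul_rpow hε'.le hs'.le]
      have h2 : ((s ^ d : ℝ) : ℂ) * ((s ^ (-d) : ℝ) : ℂ) = 1 := by
        rw [← Complex.ofReal_mul, ← Real.rpow_add hs']; simp
      push_cast
      linear_combination (((deriv φ₀ s : ℝ) : ℂ) * ((ε ^ (-d) : ℝ) : ℂ) *
        ∫ a in {a | ρ a < ε * s}, F a ∂P) * h2
  have hval : (L * -((∫ s : ℝ in Set.Ioi 0, s ^ d * deriv φ₀ s : ℝ) : ℂ)) =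
      -∫ s : ℝ in Set.Ioi 0, ((s ^ d * deriv φ₀ s : ℝ) : ℂ) * L := by
    rw [integral_mul_const, integral_complex_ofReal]; ring
  rw [hval]
  refine hlimint.neg.congr' ?_
  filter_upwards [self_mem_nhdsWithin] with ε hε
  rw [(key ε hε).2.2, integral_const_mul]
  ring

theorem bk_pos {κ : ℝ} (hκ : 0 < κ) : 0 < bk κ :=
  div_pos (Real.Gamma_pos_of_pos (by linarith))
    (mul_pos (Real.sqrt_pos.2 Real.pi_pos) (Real.Gamma_pos_of_pos hκ))

theorem Phi_eq_rpow_mul_rpow {κ u : ℝ} (hu : u ∈ Set.Ioo (-1 : ℝ) 1) :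
    Phi κ u = bk κ * (1 + u) ^ κ * (1 - u) ^ (κ - 1) := by
  have h1 : 0 < 1 + u := by linarith [hu.1]
  have h2 : 0 < 1 - u := by linarith [hu.2]
  have h3 : (1 - u ^ 2) = (1 + u) * (1 - u) := by ring
  have h4 : (1 + u) ^ κ = (1 + u) * (1 + u) ^ (κ - 1) := by
    rw [Real.rpow_sub_one h1.ne']; field_simp
  rw [Phi, h3, Real.mul_rpow h1.le h2.le, h4]; ring

theorem Phi_nonneg {κ u : ℝ} (hκ : 0 < κ) (hu : u ∈ Set.Ioo (-1 : ℝ) 1) : 0 ≤ Phi κ u := by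
  have h1 : 0 < 1 + u := by linarith [hu.1]
  have h2 : 0 < 1 - u := by linarith [hu.2]
  have := bk_pos hκ
  rw [Phi_eq_rpow_mul_rpow hu]
  positivity

theorem measurable_Phi (κ : ℝ) : Measurable (Phi κ) := by
  unfold Phi
  fun_prop

theorem integrableOn_one_sub_rpow {κ : ℝ} (hκ : 0 < κ) (a : ℝ) :
    IntegrableOn (fun u : ℝ => (1 - u) ^ (κ - 1)) (Set.Ioo a 1) := by
  rcases le_or_gt 1 a with h | h
  · simp [Set.Ioo_eq_empty (not_lt.2 h)]
  have h1 : IntervalIntegrable (fun u : ℝ => u ^ (κ - 1)) volume (1 - a) (1 - 1) :=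
    intervalIntegral.intervalIntegrable_rpow' (by linarith)
  have h2 := h1.comp_sub_left 1
  simp only [sub_sub_cancel] at h2
  rw [intervalIntegrable_iff_integrableOn_Ioo_of_le h.le] at h2
  exact h2

theorem integral_one_sub_rpow {κ : ℝ} (hκ : 0 < κ) {δ : ℝ} (hδ : 0 ≤ δ) :
    ∫ u in Set.Ioo (1 - δ) 1, (1 - u) ^ (κ - 1) = δ ^ κ / κ := by
  rw [← integral_Ioc_eq_integral_Ioo, ← intervalIntegral.integral_of_le (by linarith),
    intervalIntegral.integral_comp_sub_left (fun u : ℝ => u ^ (κ - 1)) 1,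
    integral_rpow (Or.inl (by linarith))]
  simp [Real.zero_rpow hκ.ne']

theorem integrableOn_Phi {κ : ℝ} (hκ : 0 < κ) : IntegrableOn (Phi κ) (Set.Ioo (-1) 1) := by
  refine ((integrableOn_one_sub_rpow hκ (-1)).const_mul (bk κ * 2 ^ κ)).mono'
    (measurable_Phi κ).aestronglyMeasurable ?_
  filter_upwards [ae_restrict_mem measurableSet_Ioo] with u hu
  have h1 : 0 < 1 + u := by linarith [hu.1]
  have h2 : 0 < 1 - u := by linarith [hu.2]
  have := bk_pos hκ
  rw [Real.norm_of_nonneg (Phi_nonneg hκ hu), Phi_eq_rpow_mul_rpow hu]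
  gcongr
  linarith [hu.2]

theorem integral_Phi_near_one_le {κ : ℝ} (hκ : 0 < κ) {δ : ℝ} (hδ : 0 ≤ δ) (hδ2 : δ ≤ 2) :
    ∫ u in Set.Ioo (1 - δ) 1, Phi κ u ≤ bk κ * 2 ^ κ * (δ ^ κ / κ) := by
  have hsub : Set.Ioo (1 - δ) 1 ⊆ Set.Ioo (-1 : ℝ) 1 := Set.Ioo_subset_Ioo_left (by linarith)
  rw [← integral_one_sub_rpow hκ hδ, ← integral_const_mul]
  refine setIntegral_mono_on ((integrableOn_Phi hκ).mono_set hsub)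
    ((integrableOn_one_sub_rpow hκ _).const_mul _) measurableSet_Ioo fun u hu => ?_
  have hu' := hsub hu
  have h1 : 0 < 1 + u := by linarith [hu'.1]
  have h2 : 0 < 1 - u := by linarith [hu'.2]
  have := bk_pos hκ
  rw [Phi_eq_rpow_mul_rpow hu']
  gcongr
  linarith

theorem le_integral_Phi_near_one {κ : ℝ} (hκ : 0 < κ) {δ : ℝ} (hδ : 0 ≤ δ) (hδ2 : δ ≤ 2) :
    bk κ * (2 - δ) ^ κ * (δ ^ κ / κ) ≤ ∫ u in Set.Ioo (1 - δ) 1, Phi κ u := by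
  have hsub : Set.Ioo (1 - δ) 1 ⊆ Set.Ioo (-1 : ℝ) 1 := Set.Ioo_subset_Ioo_left (by linarith)
  rw [← integral_one_sub_rpow hκ hδ, ← integral_const_mul]
  refine setIntegral_mono_on ((integrableOn_one_sub_rpow hκ _).const_mul _)
    ((integrableOn_Phi hκ).mono_set hsub) measurableSet_Ioo fun u hu => ?_
  have hu' := hsub hu
  have h1 : 0 < 1 + u := by linarith [hu'.1]
  have h2 : 0 < 1 - u := by linarith [hu'.2]
  have := bk_pos hκ
  rw [Phi_eq_rpow_mul_rpow hu']
  gcongr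
  linarith [hu.1]

theorem integral_Phi_near_neg_one_le {κ : ℝ} (hκ : 0 < κ) {δ : ℝ} (hδ : 0 ≤ δ) (hδ1 : δ ≤ 1) :
    ∫ u in Set.Ioo (-1) (-1 + δ), Phi κ u ≤ bk κ * 2 ^ κ * (δ ^ κ * δ) := by
  have hsub : Set.Ioo (-1) (-1 + δ) ⊆ Set.Ioo (-1 : ℝ) 1 := Set.Ioo_subset_Ioo_right (by linarith)
  have hc : ∫ u in Set.Ioo (-1) (-1 + δ), (bk κ * 2 ^ κ * δ ^ κ) = bk κ * 2 ^ κ * (δ ^ κ * δ) := by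
    simp [hδ]; ring
  rw [← hc]
  refine setIntegral_mono_on ((integrableOn_Phi hκ).mono_set hsub)
    (integrableOn_const (by simp)) measurableSet_Ioo fun u hu => ?_
  have hu' := hsub hu
  have h1 : 0 < 1 + u := by linarith [hu'.1]
  have h2 : 1 ≤ 1 - u := by linarith [hu.2]
  have h3 := bk_pos hκ
  have h4 : (1 - u) ^ (κ - 1) ≤ 2 ^ κ :=
    (Real.rpow_le_rpow_of_exponent_le h2 (by linarith)).trans
      (Real.rpow_le_rpow (by linarith) (by linarith [hu'.1]) hκ.le)
  have h5 : (1 + u) ^ κ ≤ δ ^ κ := Real.rpow_le_rpow h1.le (by linarith [hu.2]) hκ.le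
  rw [Phi_eq_rpow_mul_rpow hu']
  calc bk κ * (1 + u) ^ κ * (1 - u) ^ (κ - 1) ≤ bk κ * δ ^ κ * 2 ^ κ := by gcongr
    _ = _ := by ring

/-- The radius `√(x² + y² - 2xyu)` entering the generalized translation. -/
noncomputable def rho (x y u : ℝ) : ℝ := Real.sqrt (y ^ 2 + x ^ 2 - 2 * x * y * u)

/-- The translate of the indicator of `{|z| < r}`. -/
noncomputable def ballKernel (κ x r y : ℝ) : ℝ :=
  ∫ u in Set.Ioo (-1 : ℝ) 1, {u | rho x y u < r}.indicator (Phi κ) u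

theorem measurable_rho (x : ℝ) : Measurable fun p : ℝ × ℝ => rho x p.1 p.2 := by
  unfold rho
  fun_prop

theorem rho_pos {x : ℝ} (hx : x ≠ 0) (y : ℝ) {u : ℝ} (hu : u ∈ Set.Ioo (-1 : ℝ) 1) :
    0 < rho x y u := by
  refine Real.sqrt_pos.2 ?_
  have h1 : 0 < 1 - u ^ 2 := by nlinarith [hu.1, hu.2]
  have h2 : 0 < x ^ 2 := by positivity
  nlinarith [sq_nonneg (y - x * u), mul_pos h2 h1]

theorem rho_lt_iff {x y u r : ℝ} (hr : 0 < r) :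
    rho x y u < r ↔ y ^ 2 + x ^ 2 - 2 * x * y * u < r ^ 2 := Real.sqrt_lt' hr

theorem measurableSet_rho_lt (x y r : ℝ) : MeasurableSet {u | rho x y u < r} :=
  measurableSet_lt ((measurable_rho x).comp measurable_prodMk_left) measurable_const

theorem ballKernel_eq (κ x r y : ℝ) :
    ballKernel κ x r y = ∫ u in Set.Ioo (-1 : ℝ) 1 ∩ {u | rho x y u < r}, Phi κ u :=
  setIntegral_indicator (measurableSet_rho_lt x y r)

theorem ballKernel_nonneg {κ : ℝ} (hκ : 0 < κ) (x r y : ℝ) : 0 ≤ ballKernel κ x r y := by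
  refine setIntegral_nonneg measurableSet_Ioo fun u hu => ?_
  exact Set.indicator_apply_nonneg fun _ => Phi_nonneg hκ hu

theorem ballKernel_le {κ : ℝ} (hκ : 0 < κ) (x r y : ℝ) {s : Set ℝ} (hs : MeasurableSet s)
    (hs1 : s ⊆ Set.Ioo (-1) 1) (hsub : ∀ u ∈ Set.Ioo (-1 : ℝ) 1, rho x y u < r → u ∈ s) :
    ballKernel κ x r y ≤ ∫ u in s, Phi κ u := by
  rw [ballKernel_eq]
  refine setIntegral_mono_set ((integrableOn_Phi hκ).mono_set hs1) ?_
    (Eventually.of_forall fun u hu => hsub u hu.1 hu.2)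
  filter_upwards [ae_restrict_mem hs] with u hu
  exact Phi_nonneg hκ (hs1 hu)

theorem half_sq_le_mul {x y r : ℝ} (hrx : r ≤ |x| / 2) (hy : |y - x| < r) : x ^ 2 / 2 ≤ x * y := by
  have h1 : |x * (y - x)| ≤ |x| * (|x| / 2) := by
    rw [abs_mul]; gcongr; linarith
  have h2 := (abs_le.1 h1).1
  nlinarith [sq_abs x]

theorem ballKernel_eq_integral_near_one {κ x r y : ℝ} (hx : x ≠ 0) (hr : 0 < r)
    (hrx : r ≤ |x| / 2) (hy : |y - x| < r) :
    ballKernel κ x r y = ∫ u in Set.Ioo (1 - (r ^ 2 - (y - x) ^ 2) / (2 * (x * y))) 1, Phi κ u ∧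
      0 < (r ^ 2 - (y - x) ^ 2) / (2 * (x * y)) ∧
      (r ^ 2 - (y - x) ^ 2) / (2 * (x * y)) ≤ r ^ 2 / x ^ 2 ∧ r ^ 2 / x ^ 2 ≤ 1 := by
  have hx2 : 0 < x ^ 2 := by positivity
  have hxy := half_sq_le_mul hrx hy
  have hxy0 : 0 < 2 * (x * y) := by linarith
  have hsq : (y - x) ^ 2 < r ^ 2 := sq_lt_sq' (by linarith [(abs_lt.1 hy).1]) (abs_lt.1 hy).2
  have h1 : r ^ 2 / x ^ 2 ≤ 1 := by
    rw [div_le_one hx2, ← sq_abs x]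
    exact pow_le_pow_left₀ hr.le (by linarith [abs_nonneg x]) 2
  have h2 : (r ^ 2 - (y - x) ^ 2) / (2 * (x * y)) ≤ r ^ 2 / x ^ 2 := by
    refine div_le_div₀ (by positivity) (by nlinarith [sq_nonneg (y - x)]) hx2 (by linarith)
  have h0 : 0 < (r ^ 2 - (y - x) ^ 2) / (2 * (x * y)) := div_pos (by linarith) hxy0
  refine ⟨?_, h0, h2, h1⟩
  rw [ballKernel_eq]
  congr 2
  ext u
  simp only [Set.mem_inter_iff, Set.mem_Ioo, Set.mem_ofPred_eq, rho_lt_iff hr]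
  have h3 : y ^ 2 + x ^ 2 - 2 * x * y * u < r ^ 2 ↔
      1 - (r ^ 2 - (y - x) ^ 2) / (2 * (x * y)) < u := by
    rw [sub_lt_comm (a := (1 : ℝ)), lt_div_iff₀ hxy0]
    constructor <;> intro h <;> nlinarith
  rw [h3]
  constructor
  · rintro ⟨⟨_, b⟩, c⟩; exact ⟨c, b⟩
  · rintro ⟨a, b⟩; exact ⟨⟨by linarith, b⟩, a⟩

theorem ballKernel_eq_zero {κ x r y : ℝ} (hr : 0 < r) (hxy : 0 ≤ x * y) (hy : r ≤ |y - x|) :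
    ballKernel κ x r y = 0 := by
  rw [ballKernel_eq]
  have : Set.Ioo (-1 : ℝ) 1 ∩ {u | rho x y u < r} = ∅ := by
    ext u
    simp only [Set.mem_inter_iff, Set.mem_Ioo, Set.mem_ofPred_eq, rho_lt_iff hr,
      Set.mem_empty_iff_false, iff_false, not_and, not_lt]
    intro hu
    have h1 : r ^ 2 ≤ (y - x) ^ 2 := by
      rw [← sq_abs (y - x)]; exact pow_le_pow_left₀ hr.le hy 2
    nlinarith [mul_nonneg hxy (sub_nonneg.2 hu.2.le)]
  rw [this]; simp

theorem ballKernel_le_of_mul_neg {κ x r y : ℝ} (hκ : 0 < κ) (hx : x ≠ 0) (hr : 0 < r)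
    (hrx : r ≤ |x| / 2) (hxy : x * y < 0) :
    ballKernel κ x r y ≤ bk κ * 2 ^ κ * ((r ^ 2 / x ^ 2) ^ κ * (r ^ 2 / x ^ 2)) := by
  have hx2 : 0 < x ^ 2 := by positivity
  have h1 : r ^ 2 / x ^ 2 ≤ 1 := by
    rw [div_le_one hx2, ← sq_abs x]
    exact pow_le_pow_left₀ hr.le (by linarith [abs_nonneg x]) 2
  refine (ballKernel_le hκ x r y measurableSet_Ioo
    (Set.Ioo_subset_Ioo_right (by linarith)) fun u hu hlt => ?_).trans
    (integral_Phi_near_neg_one_le hκ (by positivity) h1)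
  rw [rho_lt_iff hr] at hlt
  refine ⟨hu.1, ?_⟩
  have hu1 : 0 < 1 + u := by linarith [hu.1]
  have h2 : |-y - x| < r := by
    refine abs_lt_of_sq_lt_sq ?_ hr.le
    nlinarith [mul_pos (neg_pos.2 hxy) hu1]
  have h3 := half_sq_le_mul hrx h2
  have h4 : 1 + u < r ^ 2 / x ^ 2 := by
    rw [lt_div_iff₀ hx2]
    nlinarith [sq_nonneg (y + x), mul_nonneg hu1.le (sub_nonneg.2 h3)]
  linarith

/-- Small generalized balls centred at `x ≠ 0` concentrate near `x`, up to a negligible mass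
near `-x`. -/
theorem exists_ballKernel_le {κ x : ℝ} (hκ : 0 < κ) (hx : x ≠ 0) :
    ∃ C, 0 ≤ C ∧ ∀ r, 0 < r → r ≤ |x| / 2 → ∀ y, ballKernel κ x r y ≤
      (Metric.closedBall x r).indicator (fun _ => C * r ^ (2 * κ)) y + C * r ^ (2 * κ + 2) := by
  have hx2 : 0 < x ^ 2 := by positivity
  have hb := bk_pos hκ
  set C₁ := bk κ * 2 ^ κ * ((x ^ 2)⁻¹ ^ κ / κ) with hC₁
  set C₂ := bk κ * 2 ^ κ * ((x ^ 2)⁻¹ ^ κ * (x ^ 2)⁻¹) with hC₂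
  have h1 : 0 ≤ C₁ := by positivity
  have h2 : 0 ≤ C₂ := by positivity
  refine ⟨C₁ + C₂, by positivity, fun r hr hrx y => ?_⟩
  have hp : (r ^ 2 / x ^ 2) ^ κ = r ^ (2 * κ) * (x ^ 2)⁻¹ ^ κ := by
    rw [div_eq_mul_inv, Real.mul_rpow (by positivity) (by positivity), Real.rpow_mul hr.le]
    norm_cast
  have hp2 : r ^ (2 * κ + 2) = r ^ (2 * κ) * r ^ 2 := by
    rw [Real.rpow_add hr]; norm_cast
  have hnn : 0 ≤ (Metric.closedBall x r).indicator (fun _ => (C₁ + C₂) * r ^ (2 * κ)) y :=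
    Set.indicator_apply_nonneg fun _ => by positivity
  have hnn2 : 0 ≤ (C₁ + C₂) * r ^ (2 * κ + 2) := by positivity
  rcases lt_or_ge (x * y) 0 with hxy | hxy
  · refine (ballKernel_le_of_mul_neg hκ hx hr hrx hxy).trans ?_
    have : bk κ * 2 ^ κ * ((r ^ 2 / x ^ 2) ^ κ * (r ^ 2 / x ^ 2)) = C₂ * r ^ (2 * κ + 2) := by
      rw [hp, hp2, hC₂]; ring
    rw [this]
    nlinarith [mul_nonneg h1 (Real.rpow_nonneg hr.le (2 * κ + 2))]
  rcases lt_or_ge (|y - x|) r with hy | hy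
  · obtain ⟨he, h0, hle, hle1⟩ := ballKernel_eq_integral_near_one (κ := κ) hx hr hrx hy
    have hmem : y ∈ Metric.closedBall x r := by
      rw [Metric.mem_closedBall, Real.dist_eq]; exact hy.le
    rw [he, Set.indicator_of_mem hmem]
    refine (integral_Phi_near_one_le hκ h0.le (by linarith)).trans ?_
    have h3 := Real.rpow_le_rpow h0.le hle hκ.le
    rw [hp] at h3
    calc _ ≤ bk κ * 2 ^ κ * (r ^ (2 * κ) * (x ^ 2)⁻¹ ^ κ / κ) := by gcongr
      _ = C₁ * r ^ (2 * κ) := by rw [hC₁]; ring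
      _ ≤ _ := by nlinarith [mul_nonneg h2 (Real.rpow_nonneg hr.le (2 * κ))]
  · rw [ballKernel_eq_zero hr hxy hy]
    linarith

theorem integral_one_sub_sq_rpow {κ : ℝ} (hκ : 0 < κ) :
    ∫ t in (-1 : ℝ)..1, (1 - t ^ 2) ^ κ =
      Real.sqrt π * Real.Gamma (κ + 1) / Real.Gamma (κ + 3 / 2) := by
  have h1 : (Complex.betaIntegral ((κ + 1 : ℝ) : ℂ) ((κ + 1 : ℝ) : ℂ)).re =
      ∫ x in (0 : ℝ)..1, (x * (1 - x)) ^ κ := by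
    have : Complex.betaIntegral ((κ + 1 : ℝ) : ℂ) ((κ + 1 : ℝ) : ℂ) =
        ((∫ x in (0 : ℝ)..1, (x * (1 - x)) ^ κ : ℝ) : ℂ) := by
      rw [Complex.betaIntegral, ← intervalIntegral.integral_ofReal]
      refine intervalIntegral.integral_congr fun x hx => ?_
      rw [Set.uIcc_of_le zero_le_one] at hx
      have hx1 : 0 ≤ 1 - x := by linarith [hx.2]
      rw [Real.mul_rpow hx.1 hx1, Complex.ofReal_mul, Complex.ofReal_cpow hx.1,
        Complex.ofReal_cpow hx1]
      push_cast
      simp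
    rw [this, Complex.ofReal_re]
  have h2 : ∫ t in (-1 : ℝ)..1, (1 - t ^ 2) ^ κ =
      2 * 4 ^ κ * ∫ x in (0 : ℝ)..1, (x * (1 - x)) ^ κ := by
    have h3 := intervalIntegral.mul_integral_comp_mul_sub (a := 0) (b := 1)
      (f := fun t : ℝ => (1 - t ^ 2) ^ κ) 2 1
    norm_num at h3
    have h4 : ∫ x in (0 : ℝ)..1, (1 - (2 * x - 1) ^ 2) ^ κ =
        ∫ x in (0 : ℝ)..1, 4 ^ κ * (x * (1 - x)) ^ κ := by
      refine intervalIntegral.integral_congr fun x hx => ?_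
      rw [Set.uIcc_of_le zero_le_one] at hx
      have hx1 : 0 ≤ 1 - x := by linarith [hx.2]
      rw [← Real.mul_rpow (by norm_num) (mul_nonneg hx.1 hx1)]
      congr 1
      ring
    rw [← h3, h4, intervalIntegral.integral_const_mul, mul_assoc]
  have h4 := Real.Gamma_mul_Gamma_add_half (κ + 1)
  have h5 : κ + 1 + 1 / 2 = κ + 3 / 2 := by ring
  have hG : Real.Gamma (κ + 3 / 2) ≠ 0 := (Real.Gamma_pos_of_pos (by linarith)).ne'
  have hG2 : Real.Gamma (2 * (κ + 1)) ≠ 0 := (Real.Gamma_pos_of_pos (by linarith)).ne'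
  rw [h5] at h4
  rw [h2, ← h1, ← ProbabilityTheory.beta_eq_betaIntegralReal _ _ (by linarith) (by linarith),
    ProbabilityTheory.beta, ← two_mul]
  have h6 : (2 : ℝ) * 4 ^ κ * 2 ^ (1 - 2 * (κ + 1)) = 1 := by
    rw [show (4 : ℝ) = 2 ^ (2 : ℝ) by norm_num, ← Real.rpow_mul (by norm_num)]
    nth_rw 1 [← Real.rpow_one 2]
    rw [← Real.rpow_add (by norm_num), ← Real.rpow_add (by norm_num)]
    ring_nf
    simp
  rw [mul_div_assoc', div_eq_div_iff hG2 hG]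
  linear_combination (2 * 4 ^ κ * Real.Gamma (κ + 1)) * h4 +
    Real.Gamma (κ + 1) * Real.Gamma (2 * (κ + 1)) * Real.sqrt π * h6

theorem integral_indicator_limit_profile {κ : ℝ} (hκ : 0 < κ) :
    ∫ t, (Set.Ioo (-1 : ℝ) 1).indicator (fun t => bk κ / κ * (1 - t ^ 2) ^ κ) t =
      2 / (2 * κ + 1) := by
  rw [integral_indicator measurableSet_Ioo, ← integral_Ioc_eq_integral_Ioo,
    ← intervalIntegral.integral_of_le (by norm_num), intervalIntegral.integral_const_mul,
    integral_one_sub_sq_rpow hκ, bk, Real.Gamma_add_one hκ.ne']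
  have h1 : Real.Gamma (κ + 3 / 2) = (κ + 1 / 2) * Real.Gamma (κ + 1 / 2) := by
    rw [← Real.Gamma_add_one (by linarith)]; ring_nf
  have h2 : Real.Gamma (κ + 1 / 2) ≠ 0 := (Real.Gamma_pos_of_pos (by linarith)).ne'
  have h3 : Real.Gamma κ ≠ 0 := (Real.Gamma_pos_of_pos hκ).ne'
  have h4 : Real.sqrt π ≠ 0 := (Real.sqrt_pos.2 Real.pi_pos).ne'
  have h5 : 2 * κ + 1 ≠ 0 := by linarith
  have h6 : κ + 1 / 2 ≠ 0 := by linarith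
  rw [h1]
  field_simp

theorem integral_mu {E : Type*} [NormedAddCommGroup E] [NormedSpace ℝ E] (κ : ℝ) (g : ℝ → E) :
    ∫ y, g y ∂(mu κ) = ∫ y, |y| ^ (2 * κ) • g y := by
  rw [mu, integral_withDensity_eq_integral_toReal_smul (by fun_prop) (by simp)]
  congr 1
  ext y
  rw [ENNReal.toReal_ofReal (by positivity)]

theorem measurable_ballKernel (κ x r : ℝ) : Measurable (ballKernel κ x r) := by
  have h : StronglyMeasurable fun p : ℝ × ℝ =>
      {u | rho x p.1 u < r}.indicator (Phi κ) p.2 := by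
    refine Measurable.stronglyMeasurable ?_
    have : (fun p : ℝ × ℝ => {u | rho x p.1 u < r}.indicator (Phi κ) p.2) =
        {p : ℝ × ℝ | rho x p.1 p.2 < r}.indicator fun p => Phi κ p.2 := by
      ext p; simp [Set.indicator]
    rw [this]
    exact ((measurable_Phi κ).comp measurable_snd).indicator
      (measurableSet_lt (measurable_rho x) measurable_const)
  exact (h.integral_prod_right' (ν := volume.restrict (Set.Ioo (-1 : ℝ) 1))).measurable

theorem tendsto_ballKernel_rescaled {κ x : ℝ} (hκ : 0 < κ) (hx : x ≠ 0) {t : ℝ}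
    (ht : t ∈ Set.Ioo (-1 : ℝ) 1) :
    Tendsto (fun r : ℝ => r ^ (-(2 * κ)) * (|x + r * t| ^ (2 * κ) * ballKernel κ x r (x + r * t)))
      (𝓝[>] 0) (𝓝 (bk κ / κ * (1 - t ^ 2) ^ κ)) := by
  have hx2 : 0 < x ^ 2 := by positivity
  have hb := bk_pos hκ
  have ht2 : 0 < 1 - t ^ 2 := by nlinarith [ht.1, ht.2]
  have hlim : ∀ c : ℝ → ℝ, ContinuousAt c 0 → c 0 = 2 →
      Tendsto (fun r : ℝ => |x + r * t| ^ (2 * κ) *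
        (bk κ * c r ^ κ * (((1 - t ^ 2) / (2 * (x * (x + r * t)))) ^ κ / κ)))
      (𝓝[>] 0) (𝓝 (bk κ / κ * (1 - t ^ 2) ^ κ)) := by
    intro c hc hc0
    have hcont : ContinuousAt (fun r : ℝ => |x + r * t| ^ (2 * κ) *
        (bk κ * c r ^ κ * (((1 - t ^ 2) / (2 * (x * (x + r * t)))) ^ κ / κ))) 0 := by
      have hq : ContinuousAt (fun r : ℝ => (1 - t ^ 2) / (2 * (x * (x + r * t)))) 0 := by
        refine ContinuousAt.div (by fun_prop) (by fun_prop) ?_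
        simp [hx]
      have h1 : ContinuousAt (fun r : ℝ => |x + r * t| ^ (2 * κ)) 0 :=
        ContinuousAt.rpow_const (by fun_prop) (Or.inr (by linarith))
      have h2 : ContinuousAt (fun r : ℝ => c r ^ κ) 0 := hc.rpow_const (Or.inr hκ.le)
      have h3 := hq.rpow_const (p := κ) (Or.inr hκ.le)
      exact h1.mul ((continuousAt_const.mul h2).mul (h3.div_const κ))
    have hval : |x + 0 * t| ^ (2 * κ) *
        (bk κ * c 0 ^ κ * (((1 - t ^ 2) / (2 * (x * (x + 0 * t)))) ^ κ / κ)) =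
        bk κ / κ * (1 - t ^ 2) ^ κ := by
      have h1 : |x| ^ (2 * κ) = (x ^ 2) ^ κ := by
        rw [Real.rpow_mul (abs_nonneg x), ← sq_abs x]; norm_cast
      have h2 : (x ^ 2) ^ κ ≠ 0 := (Real.rpow_pos_of_pos hx2 κ).ne'
      have h3 : (2 : ℝ) ^ κ ≠ 0 := (Real.rpow_pos_of_pos two_pos κ).ne'
      rw [zero_mul, add_zero, hc0, h1, ← sq, Real.div_rpow ht2.le (by positivity),
        Real.mul_rpow two_pos.le hx2.le]
      field_simp
    have h4 := hcont.tendsto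
    simp only [hval] at h4
    exact h4.mono_left nhdsWithin_le_nhds
  have hlow := hlim (fun r => 2 - r ^ 2 * ((1 - t ^ 2) / (2 * (x * (x + r * t))))) (by
    have hq : ContinuousAt (fun r : ℝ => (1 - t ^ 2) / (2 * (x * (x + r * t)))) 0 := by
      refine ContinuousAt.div (by fun_prop) (by fun_prop) ?_
      simp [hx]
    fun_prop) (by simp)
  have hup := hlim (fun _ => 2) continuousAt_const rfl
  have hev : ∀ᶠ r : ℝ in 𝓝[>] 0, 0 < r ∧ r ≤ |x| / 2 := by
    have : 0 < |x| / 2 := by positivity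
    filter_upwards [Ioc_mem_nhdsGT this] with r hr using hr
  have hpre : ∀ r : ℝ, 0 < r → r ≤ |x| / 2 →
      ballKernel κ x r (x + r * t) =
        ∫ u in Set.Ioo (1 - r ^ 2 * ((1 - t ^ 2) / (2 * (x * (x + r * t))))) 1, Phi κ u ∧
      0 < r ^ 2 * ((1 - t ^ 2) / (2 * (x * (x + r * t)))) ∧
      r ^ 2 * ((1 - t ^ 2) / (2 * (x * (x + r * t)))) ≤ 2 ∧
      0 < (1 - t ^ 2) / (2 * (x * (x + r * t))) := by
    intro r hr hrx
    have hy : |x + r * t - x| < r := by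
      rw [add_sub_cancel_left, abs_mul, abs_of_pos hr]
      exact mul_lt_of_lt_one_right hr (abs_lt.2 ht)
    obtain ⟨h1, h2, h3, h4⟩ := ballKernel_eq_integral_near_one (κ := κ) hx hr hrx hy
    have he : (r ^ 2 - (x + r * t - x) ^ 2) / (2 * (x * (x + r * t))) =
        r ^ 2 * ((1 - t ^ 2) / (2 * (x * (x + r * t)))) := by ring
    rw [he] at h1 h2 h3
    exact ⟨h1, h2, by linarith, pos_of_mul_pos_right h2 (by positivity)⟩
  have hpow : ∀ r : ℝ, 0 < r → ∀ q : ℝ, 0 < q → r ^ (-(2 * κ)) * (r ^ 2 * q) ^ κ = q ^ κ := by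
    intro r hr q hq
    have h1 : (r ^ 2) ^ κ = r ^ (2 * κ) := by rw [Real.rpow_mul hr.le]; norm_cast
    rw [Real.mul_rpow (by positivity) hq.le, h1, ← mul_assoc, ← Real.rpow_add hr]
    simp
  refine tendsto_of_tendsto_of_tendsto_of_le_of_le' hlow hup ?_ ?_
  · filter_upwards [hev] with r ⟨hr, hrx⟩
    obtain ⟨h1, h2, h3, h4⟩ := hpre r hr hrx
    rw [h1, mul_left_comm (r ^ (-(2 * κ)))]
    refine mul_le_mul_of_nonneg_left ?_ (Real.rpow_nonneg (abs_nonneg _) _)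
    rw [← hpow r hr _ h4]
    calc _ = r ^ (-(2 * κ)) * _ := by rw [mul_div_assoc, mul_left_comm]
      _ ≤ _ := mul_le_mul_of_nonneg_left (le_integral_Phi_near_one hκ h2.le h3) (by positivity)
  · filter_upwards [hev] with r ⟨hr, hrx⟩
    obtain ⟨h1, h2, h3, h4⟩ := hpre r hr hrx
    rw [h1, mul_left_comm (r ^ (-(2 * κ)))]
    refine mul_le_mul_of_nonneg_left ?_ (Real.rpow_nonneg (abs_nonneg _) _)
    rw [← hpow r hr _ h4]
    calc _ ≤ r ^ (-(2 * κ)) * _ :=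
          mul_le_mul_of_nonneg_left (integral_Phi_near_one_le hκ h2.le h3) (by positivity)
      _ = _ := by rw [mul_div_assoc, mul_left_comm]

theorem tendsto_integral_ballKernel {κ x : ℝ} (hκ : 0 < κ) (hx : x ≠ 0) :
    Tendsto (fun r : ℝ => r ^ (-(2 * κ + 1)) *
      ∫ y in Metric.closedBall x (|x| / 2), ballKernel κ x r y ∂(mu κ))
      (𝓝[>] 0) (𝓝 (2 / (2 * κ + 1))) := by
  have hax : 0 < |x| / 2 := by positivity
  set B := Metric.closedBall x (|x| / 2) with hB
  set G : ℝ → ℝ → ℝ := fun r t => r ^ (-(2 * κ)) *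
    (|x + r * t| ^ (2 * κ) * B.indicator (ballKernel κ x r) (x + r * t)) with hG
  have hev : ∀ᶠ r : ℝ in 𝓝[>] 0, 0 < r ∧ r ≤ |x| / 2 := by
    filter_upwards [Ioc_mem_nhdsGT hax] with r hr using hr
  have hGint : ∀ r, 0 < r → ∫ t, G r t =
      r ^ (-(2 * κ + 1)) * ∫ y in B, ballKernel κ x r y ∂(mu κ) := by
    intro r hr
    rw [← integral_indicator Metric.isClosed_closedBall.measurableSet, integral_mu]
    simp only [hG, smul_eq_mul]
    rw [integral_const_mul, Measure.integral_comp_mul_left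
      (fun s => |x + s| ^ (2 * κ) * B.indicator (ballKernel κ x r) (x + s)) r,
      integral_add_left_eq_self
      (fun s => |s| ^ (2 * κ) * B.indicator (ballKernel κ x r) s) x, smul_eq_mul, ← mul_assoc]
    congr 1
    rw [abs_of_pos (inv_pos.2 hr), neg_add, Real.rpow_add hr, Real.rpow_neg_one]
  have hGzero : ∀ r, 0 < r → ∀ t, 1 ≤ |t| → G r t = 0 := by
    intro r hr t ht
    have : B.indicator (ballKernel κ x r) (x + r * t) = 0 := by
      refine Set.indicator_apply_eq_zero.2 fun hmem => ?_
      rw [hB, Metric.mem_closedBall, Real.dist_eq] at hmem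
      refine ballKernel_eq_zero hr ?_ ?_
      · have h1 : |x * (x + r * t - x)| ≤ |x| * (|x| / 2) := by rw [abs_mul]; gcongr
        nlinarith [(abs_le.1 h1).1, sq_abs x]
      · rw [add_sub_cancel_left, abs_mul, abs_of_pos hr]
        exact le_mul_of_one_le_right hr.le ht
    simp only [hG, this, mul_zero]
  obtain ⟨C, hC, hCle⟩ := exists_ballKernel_le hκ hx
  have hlim : Tendsto (fun r => ∫ t, G r t) (𝓝[>] 0) (𝓝 (∫ t : ℝ, (Set.Ioo (-1 : ℝ) 1).indicator
      (fun t : ℝ => bk κ / κ * (1 - t ^ 2) ^ κ) t)) := by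
    refine tendsto_integral_filter_of_dominated_convergence
      ((Set.Icc (-1 : ℝ) 1).indicator fun _ =>
        (2 * |x|) ^ (2 * κ) * (C + C * x ^ 2)) ?_ ?_ ?_ ?_
    · refine Eventually.of_forall fun r => Measurable.aestronglyMeasurable ?_
      have h1 := (measurable_ballKernel κ x r).indicator
        (Metric.isClosed_closedBall (x := x) (ε := |x| / 2)).measurableSet
      have h2 : Measurable fun t : ℝ => x + r * t := by fun_prop
      have h3 : Measurable fun t : ℝ => |x + r * t| ^ (2 * κ) := by fun_prop
      exact (h3.mul (h1.comp h2)).const_mul _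
    · filter_upwards [hev] with r ⟨hr, hrx⟩
      refine Eventually.of_forall fun t => ?_
      by_cases ht : t ∈ Set.Icc (-1 : ℝ) 1
      · rw [Set.indicator_of_mem ht]
        have h0 : 0 ≤ B.indicator (ballKernel κ x r) (x + r * t) :=
          Set.indicator_apply_nonneg fun _ => ballKernel_nonneg hκ _ _ _
        have h1 : B.indicator (ballKernel κ x r) (x + r * t) ≤
            C * r ^ (2 * κ) + C * r ^ (2 * κ + 2) := by
          refine (Set.indicator_le_self' (fun _ _ => ballKernel_nonneg hκ _ _ _) _).trans
            ((hCle r hr hrx _).trans ?_)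
          gcongr
          exact Set.indicator_apply_le' (fun _ => le_rfl) fun _ => by positivity
        have h2 : |x + r * t| ≤ 2 * |x| := by
          have h3 : |r * t| ≤ |x| / 2 := by
            rw [abs_mul, abs_of_pos hr]
            calc r * |t| ≤ r * 1 := by gcongr; exact abs_le.2 ht
              _ ≤ _ := by linarith
          linarith [abs_add_le x (r * t), abs_nonneg x]
        have h3 : r ^ (2 * κ + 2) ≤ r ^ (2 * κ) * x ^ 2 := by
          rw [Real.rpow_add hr, ← sq_abs x]
          have h4 : r ^ (2 : ℝ) = r ^ 2 := by norm_cast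
          rw [h4]
          gcongr
          linarith
        have h5 : r ^ (-(2 * κ)) * r ^ (2 * κ) = 1 := by rw [← Real.rpow_add hr]; simp
        rw [Real.norm_of_nonneg (mul_nonneg (by positivity) (mul_nonneg (by positivity) h0))]
        calc _ ≤ r ^ (-(2 * κ)) * ((2 * |x|) ^ (2 * κ) *
              (C * r ^ (2 * κ) + C * (r ^ (2 * κ) * x ^ 2))) := by
              gcongr
              exact h1.trans (by gcongr)
          _ = (r ^ (-(2 * κ)) * r ^ (2 * κ)) * ((2 * |x|) ^ (2 * κ) * (C + C * x ^ 2)) := by ring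
          _ = _ := by rw [h5, one_mul]
      · rw [Set.indicator_of_notMem ht, hGzero r hr t, norm_zero]
        by_contra hlt
        exact ht (abs_le.1 (not_le.1 hlt).le)
    · rw [integrable_indicator_iff measurableSet_Icc]
      exact integrableOn_const (by simp)
    · refine Eventually.of_forall fun t => ?_
      by_cases ht : t ∈ Set.Ioo (-1 : ℝ) 1
      · rw [Set.indicator_of_mem ht]
        refine (tendsto_ballKernel_rescaled hκ hx ht).congr' ?_
        filter_upwards [hev] with r ⟨hr, hrx⟩
        have hmem : x + r * t ∈ B := by
          rw [hB, Metric.mem_closedBall, Real.dist_eq, add_sub_cancel_left, abs_mul, abs_of_pos hr]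
          calc r * |t| ≤ r * 1 := by gcongr; exact (abs_lt.2 ht).le
            _ ≤ _ := by linarith
        simp only [hG, Set.indicator_of_mem hmem]
      · rw [Set.indicator_of_notMem ht]
        refine tendsto_const_nhds.congr' ?_
        filter_upwards [hev] with r ⟨hr, hrx⟩
        rw [hGzero r hr t]
        by_contra hlt
        exact ht (abs_lt.1 (not_le.1 hlt))
  rw [integral_indicator_limit_profile hκ] at hlim
  refine hlim.congr' ?_
  filter_upwards [hev] with r hr
  exact hGint r hr.1

theorem lintegral_rho_lt {κ : ℝ} (hκ : 0 < κ) (x r : ℝ) {h : ℝ → ℂ}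
    (hh : AEStronglyMeasurable h (mu κ)) :
    ∫⁻ p in {p : ℝ × ℝ | rho x p.1 p.2 < r}, ‖h p.1 * ((Phi κ p.2 : ℝ) : ℂ)‖ₑ
      ∂((mu κ).prod (volume.restrict (Set.Ioo (-1 : ℝ) 1))) =
    ∫⁻ y, ‖h y‖ₑ * ENNReal.ofReal (ballKernel κ x r y) ∂(mu κ) := by
  have : SFinite (mu κ) := by unfold mu; infer_instance
  have hm : MeasurableSet {p : ℝ × ℝ | rho x p.1 p.2 < r} :=
    measurableSet_lt (measurable_rho x) measurable_const
  have hF : AEStronglyMeasurable (fun p : ℝ × ℝ => h p.1 * ((Phi κ p.2 : ℝ) : ℂ))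
      ((mu κ).prod (volume.restrict (Set.Ioo (-1 : ℝ) 1))) :=
    hh.comp_fst.mul (Complex.measurable_ofReal.comp
      ((measurable_Phi κ).comp measurable_snd)).aestronglyMeasurable
  rw [← lintegral_indicator hm, lintegral_prod _ (hF.enorm.indicator hm)]
  refine lintegral_congr fun y => ?_
  have h1 : ∀ u, {p : ℝ × ℝ | rho x p.1 p.2 < r}.indicator
      (fun p => ‖h p.1 * ((Phi κ p.2 : ℝ) : ℂ)‖ₑ) (y, u) =
      ‖h y‖ₑ * ‖{u | rho x y u < r}.indicator (Phi κ) u‖ₑ := by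
    intro u
    by_cases hu : rho x y u < r
    · rw [Set.indicator_of_mem (show (y, u) ∈ {p : ℝ × ℝ | rho x p.1 p.2 < r} from hu),
        Set.indicator_of_mem (show u ∈ {u | rho x y u < r} from hu), enorm_mul]
      congr 1
      rw [← ofReal_norm, Complex.norm_real, ofReal_norm]
    · rw [Set.indicator_of_notMem (show (y, u) ∉ {p : ℝ × ℝ | rho x p.1 p.2 < r} from hu),
        Set.indicator_of_notMem (show u ∉ {u | rho x y u < r} from hu)]
      simp
  simp_rw [h1]
  rw [lintegral_const_mul' _ _ (by simp)]
  congr 1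
  rw [ballKernel, ofReal_integral_eq_lintegral_ofReal]
  · refine lintegral_congr_ae ?_
    filter_upwards [ae_restrict_mem measurableSet_Ioo] with u hu
    rw [Real.enorm_of_nonneg]
    exact Set.indicator_apply_nonneg fun _ => Phi_nonneg hκ hu
  · exact (integrableOn_Phi hκ).indicator (measurableSet_rho_lt x y r)
  · filter_upwards [ae_restrict_mem measurableSet_Ioo] with u hu
    exact Set.indicator_apply_nonneg fun _ => Phi_nonneg hκ hu

theorem exists_lintegral_rho_lt_le {κ x : ℝ} (hκ : 0 < κ) (hx : x ≠ 0) :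
    ∃ C, 0 ≤ C ∧ ∀ r, 0 < r → r ≤ |x| / 2 → ∀ h : ℝ → ℂ, AEStronglyMeasurable h (mu κ) →
      ∫⁻ p in {p : ℝ × ℝ | rho x p.1 p.2 < r}, ‖h p.1 * ((Phi κ p.2 : ℝ) : ℂ)‖ₑ
        ∂((mu κ).prod (volume.restrict (Set.Ioo (-1 : ℝ) 1))) ≤
      ENNReal.ofReal (C * r ^ (2 * κ)) * ∫⁻ y in Metric.closedBall x r, ‖h y‖ₑ ∂(mu κ) +
      ENNReal.ofReal (C * r ^ (2 * κ + 2)) * ∫⁻ y, ‖h y‖ₑ ∂(mu κ) := by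
  obtain ⟨C, hC, hle⟩ := exists_ballKernel_le hκ hx
  refine ⟨C, hC, fun r hr hrx h hh => ?_⟩
  have hm : MeasurableSet (Metric.closedBall x r) := Metric.isClosed_closedBall.measurableSet
  rw [lintegral_rho_lt hκ x r hh, ← lintegral_const_mul' _ _ ENNReal.ofReal_ne_top,
    ← lintegral_const_mul' _ _ ENNReal.ofReal_ne_top, ← lintegral_indicator hm,
    ← lintegral_add_left' ((hh.enorm.const_mul _).indicator hm)]
  refine lintegral_mono fun y => ?_
  have h1 := ENNReal.ofReal_le_ofReal (hle r hr hrx y)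
  by_cases hy : y ∈ Metric.closedBall x r
  · rw [Set.indicator_of_mem hy] at h1 ⊢
    rw [ENNReal.ofReal_add (by positivity) (by positivity)] at h1
    calc _ ≤ ‖h y‖ₑ * _ := mul_le_mul_right h1 _
      _ = _ := by ring
  · rw [Set.indicator_of_notMem hy, zero_add] at h1 ⊢
    rw [mul_comm]
    exact mul_le_mul_left h1 _

theorem mu_closedBall_le {κ : ℝ} (hκ : 0 < κ) {x r : ℝ} (hr : 0 < r) (hrx : r ≤ |x| / 2) :
    mu κ (Metric.closedBall x r) ≤ ENNReal.ofReal (2 * (2 * |x|) ^ (2 * κ) * r) := by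
  have hm : MeasurableSet (Metric.closedBall x r) := Metric.isClosed_closedBall.measurableSet
  rw [mu, withDensity_apply _ hm]
  calc ∫⁻ t in Metric.closedBall x r, ENNReal.ofReal (|t| ^ (2 * κ))
      ≤ ∫⁻ _t in Metric.closedBall x r, ENNReal.ofReal ((2 * |x|) ^ (2 * κ)) := by
        refine setLIntegral_mono' hm fun t ht => ENNReal.ofReal_le_ofReal ?_
        rw [Metric.mem_closedBall, Real.dist_eq] at ht
        have h1 : |t| ≤ 2 * |x| := by
          have := abs_add_le x (t - x)
          rw [add_sub_cancel] at this
          linarith [abs_nonneg x]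
        exact Real.rpow_le_rpow (abs_nonneg t) h1 (by linarith)
    _ = ENNReal.ofReal (2 * (2 * |x|) ^ (2 * κ) * r) := by
        rw [setLIntegral_const, Real.volume_closedBall, ← ENNReal.ofReal_mul (by positivity)]
        ring_nf

theorem ae_lebesgue_point {κ : ℝ} (hκ : 0 < κ) {f : ℝ → ℂ} (hf : Integrable f (mu κ)) :
    ∀ᵐ x ∂(mu κ), x ≠ 0 ∧ ∃ a : ℝ → ℝ, Tendsto a (𝓝[>] 0) (𝓝 0) ∧ (∀ r, 0 ≤ a r) ∧
      ∀ r, 0 < r → r ≤ |x| / 2 →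
        ∫⁻ y in Metric.closedBall x r, ‖f y - f x‖ₑ ∂(mu κ) ≤ ENNReal.ofReal (r * a r) := by
  have : SFinite (mu κ) := by unfold mu; infer_instance
  have : IsLocallyFiniteMeasure (mu κ) := by
    refine IsLocallyFiniteMeasure.withDensity_ofReal ?_
    exact continuous_abs.rpow_const fun _ => Or.inr (by linarith)
  have h0 : ∀ᵐ x ∂(mu κ), x ≠ 0 :=
    (withDensity_absolutelyContinuous _ _).ae_le (Measure.ae_ne volume 0)
  filter_upwards [h0, (Besicovitch.vitaliFamily (mu κ)).ae_tendsto_average_norm_sub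
    hf.locallyIntegrable] with x hx hL
  have hL' := hL.comp (Besicovitch.tendsto_filterAt (mu κ) x)
  refine ⟨hx, fun r => 2 * (2 * |x|) ^ (2 * κ) *
    ⨍ y in Metric.closedBall x r, ‖f y - f x‖ ∂(mu κ), ?_, ?_, ?_⟩
  · simpa using hL'.const_mul (2 * (2 * |x|) ^ (2 * κ))
  · intro r
    have : 0 ≤ ⨍ y in Metric.closedBall x r, ‖f y - f x‖ ∂(mu κ) :=
      integral_nonneg fun _ => norm_nonneg _
    positivity
  · intro r hr hrx
    have hfin : mu κ (Metric.closedBall x r) < ⊤ :=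
      (mu_closedBall_le hκ hr hrx).trans_lt ENNReal.ofReal_lt_top
    have hi : IntegrableOn (fun y => f y - f x) (Metric.closedBall x r) (mu κ) :=
      hf.integrableOn.sub (integrableOn_const hfin.ne)
    have hav : 0 ≤ ⨍ y in Metric.closedBall x r, ‖f y - f x‖ ∂(mu κ) :=
      integral_nonneg fun _ => norm_nonneg _
    rw [← ofReal_integral_norm_eq_lintegral_enorm hi]
    refine ENNReal.ofReal_le_ofReal ?_
    rw [← measure_smul_setAverage _ hfin.ne, smul_eq_mul]
    have h1 : (mu κ).real (Metric.closedBall x r) ≤ 2 * (2 * |x|) ^ (2 * κ) * r :=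
      ENNReal.toReal_le_of_le_ofReal (by positivity) (mu_closedBall_le hκ hr hrx)
    calc _ ≤ 2 * (2 * |x|) ^ (2 * κ) * r * _ := mul_le_mul_of_nonneg_right h1 hav
      _ = _ := by ring

theorem mu_abs_lt {κ : ℝ} (hκ : 0 < κ) {r : ℝ} (hr : 0 < r) :
    mu κ {x | |x| < r} = ENNReal.ofReal (2 / (2 * κ + 1) * r ^ (2 * κ + 1)) := by
  have hs : {x : ℝ | |x| < r} = Set.Ioo (-r) r := by ext x; simp [abs_lt]
  have hc : Continuous fun t : ℝ => |t| ^ (2 * κ) :=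
    continuous_abs.rpow_const fun _ => Or.inr (by linarith)
  rw [hs, mu, withDensity_apply _ measurableSet_Ioo, ← ofReal_integral_eq_lintegral_ofReal
    ((hc.integrableOn_Icc (a := -r) (b := r)).mono_set Set.Ioo_subset_Icc_self)
    (Eventually.of_forall fun t => by positivity)]
  congr 1
  have h1 : ∫ t in Set.Ioo (-r) r, |t| ^ (2 * κ) =
      ∫ t, (fun s : ℝ => (Set.Iio r).indicator (fun s => s ^ (2 * κ)) s) |t| := by
    rw [← integral_indicator measurableSet_Ioo]
    congr 1
    ext t
    simp only [Set.indicator, Set.mem_Ioo, Set.mem_Iio, abs_lt]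
  rw [h1, integral_comp_abs, setIntegral_indicator measurableSet_Iio, Set.Ioi_inter_Iio,
    ← integral_Ioc_eq_integral_Ioo, ← intervalIntegral.integral_of_le hr.le,
    integral_rpow (Or.inl (by linarith)), Real.zero_rpow (by linarith)]
  ring

theorem integral_radial_mu {κ : ℝ} (hκ : 0 < κ) {φ₀ : ℝ → ℝ}
    (hdiff : DifferentiableOn ℝ φ₀ (Set.Ici 0)) (hlim : Tendsto φ₀ atTop (nhds 0))
    (hint : IntegrableOn (fun r => r ^ (2 * κ + 1) * |deriv φ₀ r|) (Set.Ioi 0)) :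
    ∫ x, ((φ₀ |x| : ℝ) : ℂ) ∂(mu κ) =
      ((2 / (2 * κ + 1) : ℝ) : ℂ) *
        -((∫ s : ℝ in Set.Ioi 0, s ^ (2 * κ + 1) * deriv φ₀ s : ℝ) : ℂ) := by
  have : SFinite (mu κ) := by unfold mu; infer_instance
  have h0 : ∀ᵐ x ∂(mu κ), 0 < |x| := by
    filter_upwards [(withDensity_absolutelyContinuous _ _).ae_le
      (Measure.ae_ne volume (0 : ℝ))] with x hx using abs_pos.2 hx
  have h := (integral_mul_radial_eq (P := mu κ) (F := fun _ => (1 : ℂ)) (ρ := fun x : ℝ => |x|)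
    aestronglyMeasurable_const continuous_abs.measurable h0 (by linarith) hdiff hlim hint
    (M := 2 / (2 * κ + 1)) (by
      intro r hr
      rw [← mu_abs_lt hκ hr]
      simp)).2.2
  simp only [one_mul] at h
  rw [h, mul_neg, ← integral_complex_ofReal, ← integral_const_mul]
  congr 1
  refine setIntegral_congr_fun measurableSet_Ioi fun s hs => ?_
  have hs' : 0 < s := hs
  have h1 : (mu κ).real {a | |a| < s} = 2 / (2 * κ + 1) * s ^ (2 * κ + 1) := by
    rw [measureReal_def, mu_abs_lt hκ hs', ENNReal.toReal_ofReal (by positivity)]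
  simp only [integral_const, measureReal_restrict_apply_univ, h1]
  push_cast
  simp
  ring

theorem setIntegral_rho_lt {κ x r : ℝ} {h : ℝ → ℂ}
    (hi : Integrable (fun p : ℝ × ℝ => h p.1 * ((Phi κ p.2 : ℝ) : ℂ))
      ((mu κ).prod (volume.restrict (Set.Ioo (-1 : ℝ) 1)))) :
    ∫ p in {p : ℝ × ℝ | rho x p.1 p.2 < r}, h p.1 * ((Phi κ p.2 : ℝ) : ℂ)
      ∂((mu κ).prod (volume.restrict (Set.Ioo (-1 : ℝ) 1))) =
    ∫ y, h y * ((ballKernel κ x r y : ℝ) : ℂ) ∂(mu κ) := by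
  have : SFinite (mu κ) := by unfold mu; infer_instance
  have hm : MeasurableSet {p : ℝ × ℝ | rho x p.1 p.2 < r} :=
    measurableSet_lt (measurable_rho x) measurable_const
  rw [← integral_indicator hm, integral_prod _ (hi.indicator hm)]
  congr 1
  ext y
  have h1 : ∀ u, {p : ℝ × ℝ | rho x p.1 p.2 < r}.indicator
      (fun p => h p.1 * ((Phi κ p.2 : ℝ) : ℂ)) (y, u) =
      h y * (({u | rho x y u < r}.indicator (Phi κ) u : ℝ) : ℂ) := by
    intro u
    by_cases hu : rho x y u < r
    · rw [Set.indicator_of_mem (show (y, u) ∈ {p : ℝ × ℝ | rho x p.1 p.2 < r} from hu),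
        Set.indicator_of_mem (show u ∈ {u | rho x y u < r} from hu)]
    · rw [Set.indicator_of_notMem (show (y, u) ∉ {p : ℝ × ℝ | rho x p.1 p.2 < r} from hu),
        Set.indicator_of_notMem (show u ∉ {u | rho x y u < r} from hu)]
      simp
  simp_rw [h1]
  rw [integral_const_mul, integral_complex_ofReal, ballKernel]

theorem integrable_mul_Phi {κ : ℝ} (hκ : 0 < κ) {h : ℝ → ℂ} (hh : Integrable h (mu κ)) :
    Integrable (fun p : ℝ × ℝ => h p.1 * ((Phi κ p.2 : ℝ) : ℂ))
      ((mu κ).prod (volume.restrict (Set.Ioo (-1 : ℝ) 1))) := by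
  have : SFinite (mu κ) := by unfold mu; infer_instance
  exact hh.mul_prod (g := fun u => ((Phi κ u : ℝ) : ℂ)) (integrableOn_Phi hκ).ofReal

theorem tendsto_setIntegral_rho_lt {κ x : ℝ} (hκ : 0 < κ) (hx : x ≠ 0) {f : ℝ → ℂ}
    (hf : Integrable f (mu κ)) {a : ℝ → ℝ} (ha : Tendsto a (𝓝[>] 0) (𝓝 0)) (ha0 : ∀ r, 0 ≤ a r)
    (hfa : ∀ r, 0 < r → r ≤ |x| / 2 →
      ∫⁻ y in Metric.closedBall x r, ‖f y - f x‖ₑ ∂(mu κ) ≤ ENNReal.ofReal (r * a r)) :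
    Tendsto (fun r : ℝ => ((r ^ (-(2 * κ + 1)) : ℝ) : ℂ) *
      ∫ p in {p : ℝ × ℝ | rho x p.1 p.2 < r}, f p.1 * ((Phi κ p.2 : ℝ) : ℂ)
        ∂((mu κ).prod (volume.restrict (Set.Ioo (-1 : ℝ) 1))))
      (𝓝[>] 0) (𝓝 (f x * ((2 / (2 * κ + 1) : ℝ) : ℂ))) := by
  have hax : 0 < |x| / 2 := by positivity
  set B := Metric.closedBall x (|x| / 2) with hB
  have hBm : MeasurableSet B := Metric.isClosed_closedBall.measurableSet
  have hBfin : mu κ B < ⊤ := (mu_closedBall_le hκ hax le_rfl).trans_lt ENNReal.ofReal_lt_top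
  set c : ℝ → ℂ := B.indicator fun _ => f x with hc
  have hci : Integrable c (mu κ) :=
    (integrable_indicator_iff hBm).2 (integrableOn_const hBfin.ne)
  have hev : ∀ᶠ r : ℝ in 𝓝[>] 0, 0 < r ∧ r ≤ |x| / 2 := by
    filter_upwards [Ioc_mem_nhdsGT hax] with r hr using hr
  have hh : Integrable (fun y => f y - c y) (mu κ) := hf.sub hci
  have hsplit : ∀ r : ℝ, ((r ^ (-(2 * κ + 1)) : ℝ) : ℂ) *
      ∫ p in {p : ℝ × ℝ | rho x p.1 p.2 < r}, f p.1 * ((Phi κ p.2 : ℝ) : ℂ)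
        ∂((mu κ).prod (volume.restrict (Set.Ioo (-1 : ℝ) 1))) =
      ((r ^ (-(2 * κ + 1)) : ℝ) : ℂ) *
        ∫ p in {p : ℝ × ℝ | rho x p.1 p.2 < r}, (f p.1 - c p.1) * ((Phi κ p.2 : ℝ) : ℂ)
        ∂((mu κ).prod (volume.restrict (Set.Ioo (-1 : ℝ) 1))) +
      f x * ((r ^ (-(2 * κ + 1)) * ∫ y in B, ballKernel κ x r y ∂(mu κ) : ℝ) : ℂ) := by
    intro r
    have h1 : ∫ p in {p : ℝ × ℝ | rho x p.1 p.2 < r}, c p.1 * ((Phi κ p.2 : ℝ) : ℂ)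
        ∂((mu κ).prod (volume.restrict (Set.Ioo (-1 : ℝ) 1))) =
        f x * ((∫ y in B, ballKernel κ x r y ∂(mu κ) : ℝ) : ℂ) := by
      rw [setIntegral_rho_lt (integrable_mul_Phi hκ hci), ← integral_complex_ofReal,
        ← integral_const_mul, ← integral_indicator hBm]
      congr 1
      ext y
      by_cases hy : y ∈ B <;> simp [hc, hy]
    have h2 := integral_add
      ((integrable_mul_Phi hκ hh).restrict (s := {p : ℝ × ℝ | rho x p.1 p.2 < r}))
      ((integrable_mul_Phi hκ hci).restrict (s := {p : ℝ × ℝ | rho x p.1 p.2 < r}))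
    simp only [sub_mul, sub_add_cancel] at h2 ⊢
    rw [h2, h1]
    push_cast
    ring
  have hmain : Tendsto (fun r : ℝ => ((r ^ (-(2 * κ + 1)) : ℝ) : ℂ) *
      ∫ p in {p : ℝ × ℝ | rho x p.1 p.2 < r}, (f p.1 - c p.1) * ((Phi κ p.2 : ℝ) : ℂ)
        ∂((mu κ).prod (volume.restrict (Set.Ioo (-1 : ℝ) 1)))) (𝓝[>] 0) (𝓝 0) := by
    obtain ⟨C, hC, hCle⟩ := exists_lintegral_rho_lt_le hκ hx
    set N := ∫ y, ‖f y - c y‖ ∂(mu κ) with hN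
    have hN0 : 0 ≤ N := integral_nonneg fun _ => norm_nonneg _
    have hlim : Tendsto (fun r : ℝ => C * a r + C * N * r) (𝓝[>] 0) (𝓝 0) := by
      have h1 : Tendsto (fun r : ℝ => r) (𝓝[>] 0) (𝓝 0) := nhdsWithin_le_nhds
      simpa using (ha.const_mul C).add (h1.const_mul (C * N))
    refine squeeze_zero_norm' ?_ hlim
    filter_upwards [hev] with r ⟨hr, hrx⟩
    have h1 := hCle r hr hrx _ hh.1
    have h2 : ∫⁻ y in Metric.closedBall x r, ‖f y - c y‖ₑ ∂(mu κ) ≤ ENNReal.ofReal (r * a r) := by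
      refine le_trans (le_of_eq ?_) (hfa r hr hrx)
      refine setLIntegral_congr_fun Metric.isClosed_closedBall.measurableSet fun y hy => ?_
      have hmem : y ∈ B := Metric.closedBall_subset_closedBall hrx hy
      simp only [hc, Set.indicator_of_mem hmem]
    rw [← ofReal_integral_norm_eq_lintegral_enorm hh] at h1
    have h3 := (enorm_integral_le_lintegral_enorm _).trans
      (h1.trans (add_le_add_left (mul_le_mul_right h2 _) _))
    have har := ha0 r
    rw [← ENNReal.ofReal_mul (by positivity), ← ENNReal.ofReal_mul (by positivity),
      ← ENNReal.ofReal_add (by positivity) (by positivity), ← ofReal_norm,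
      ENNReal.ofReal_le_ofReal_iff (by positivity)] at h3
    have h4 : r ^ (-(2 * κ + 1)) * (r ^ (2 * κ) * r) = 1 := by
      rw [← Real.rpow_add_one hr.ne', ← Real.rpow_add hr]; simp
    have h5 : r ^ (2 * κ + 2) = r ^ (2 * κ) * r * r := by
      rw [Real.rpow_add hr, Real.rpow_two]; ring
    rw [norm_mul, Complex.norm_real, Real.norm_of_nonneg (by positivity)]
    calc _ ≤ r ^ (-(2 * κ + 1)) *
          (C * r ^ (2 * κ) * (r * a r) + C * r ^ (2 * κ + 2) * N) := by gcongr
      _ = r ^ (-(2 * κ + 1)) * (r ^ (2 * κ) * r) * (C * a r + C * N * r) := by rw [h5]; ring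
      _ = _ := by rw [h4, one_mul]
  have h2 : Tendsto (fun r : ℝ => f x *
      ((r ^ (-(2 * κ + 1)) * ∫ y in B, ballKernel κ x r y ∂(mu κ) : ℝ) : ℂ))
      (𝓝[>] 0) (𝓝 (f x * ((2 / (2 * κ + 1) : ℝ) : ℂ))) :=
    (Tendsto.comp (Complex.continuous_ofReal.tendsto _)
      (tendsto_integral_ballKernel hκ hx)).const_mul (f x)
  have h3 := hmain.add h2
  rw [zero_add] at h3
  exact h3.congr fun r => (hsplit r).symm

theorem exists_lintegral_rho_lt_le_rpow {κ x : ℝ} (hκ : 0 < κ) (hx : x ≠ 0) {f : ℝ → ℂ}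
    (hf : Integrable f (mu κ)) {a : ℝ → ℝ} (ha : Tendsto a (𝓝[>] 0) (𝓝 0))
    (hfa : ∀ r, 0 < r → r ≤ |x| / 2 →
      ∫⁻ y in Metric.closedBall x r, ‖f y - f x‖ₑ ∂(mu κ) ≤ ENNReal.ofReal (r * a r)) :
    ∃ M : ℝ, ∀ r, 0 < r →
      ∫⁻ p in {p : ℝ × ℝ | rho x p.1 p.2 < r}, ‖f p.1 * ((Phi κ p.2 : ℝ) : ℂ)‖ₑ
        ∂((mu κ).prod (volume.restrict (Set.Ioo (-1 : ℝ) 1))) ≤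
      ENNReal.ofReal (M * r ^ (2 * κ + 1)) := by
  have hax : 0 < |x| / 2 := by positivity
  obtain ⟨C, hC, hCle⟩ := exists_lintegral_rho_lt_le hκ hx
  have hev : ∀ᶠ r : ℝ in 𝓝[>] 0, r ≤ |x| / 2 ∧ a r ≤ 1 := by
    filter_upwards [Ioc_mem_nhdsGT hax, ha.eventually_le_const one_pos] with r hr har
    exact ⟨hr.2, har⟩
  obtain ⟨r₀, hr₀, hr₀le⟩ := mem_nhdsGT_iff_exists_Ioc_subset.1 hev
  have hr₀' : 0 < r₀ := hr₀
  set N := ∫ y, ‖f y‖ ∂(mu κ) with hN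
  have hN0 : 0 ≤ N := integral_nonneg fun _ => norm_nonneg _
  set T := ∫ p, ‖f p.1 * ((Phi κ p.2 : ℝ) : ℂ)‖
    ∂((mu κ).prod (volume.restrict (Set.Ioo (-1 : ℝ) 1))) with hT
  have hT0 : 0 ≤ T := integral_nonneg fun _ => norm_nonneg _
  set D := 1 + ‖f x‖ * (2 * (2 * |x|) ^ (2 * κ)) with hD
  have hD0 : 0 ≤ D := by positivity
  refine ⟨C * D + C * N * r₀ + T * r₀ ^ (-(2 * κ + 1)), fun r hr => ?_⟩
  rcases le_or_gt r r₀ with hle | hlt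
  · obtain ⟨hrx, har⟩ := hr₀le ⟨hr, hle⟩
    have h1 := hCle r hr hrx f hf.1
    have h2 : ∫⁻ y in Metric.closedBall x r, ‖f y‖ₑ ∂(mu κ) ≤ ENNReal.ofReal (D * r) := by
      calc ∫⁻ y in Metric.closedBall x r, ‖f y‖ₑ ∂(mu κ)
          ≤ ∫⁻ y in Metric.closedBall x r, (‖f y - f x‖ₑ + ‖f x‖ₑ) ∂(mu κ) := by
            refine lintegral_mono fun y => ?_
            simpa using enorm_add_le (f y - f x) (f x)
        _ = ∫⁻ y in Metric.closedBall x r, ‖f y - f x‖ₑ ∂(mu κ) +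
              ‖f x‖ₑ * mu κ (Metric.closedBall x r) := by
            rw [lintegral_add_right _ measurable_const, setLIntegral_const]
        _ ≤ ENNReal.ofReal (r * 1) +
              ENNReal.ofReal ‖f x‖ * ENNReal.ofReal (2 * (2 * |x|) ^ (2 * κ) * r) := by
            rw [← ofReal_norm (f x)]
            refine add_le_add ((hfa r hr hrx).trans (ENNReal.ofReal_le_ofReal ?_))
              (mul_le_mul_right (mu_closedBall_le hκ hr hrx) _)
            gcongr
        _ = ENNReal.ofReal (D * r) := by
            rw [← ENNReal.ofReal_mul (norm_nonneg _),
              ← ENNReal.ofReal_add (by positivity) (by positivity), hD]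
            ring_nf
    rw [← ofReal_integral_norm_eq_lintegral_enorm hf] at h1
    refine (h1.trans (add_le_add_left (mul_le_mul_right h2 _) _)).trans ?_
    rw [← ENNReal.ofReal_mul (by positivity), ← ENNReal.ofReal_mul (by positivity),
      ← ENNReal.ofReal_add (by positivity) (by positivity)]
    refine ENNReal.ofReal_le_ofReal ?_
    have h5 : r ^ (2 * κ + 2) = r ^ (2 * κ) * r * r := by
      rw [Real.rpow_add hr, Real.rpow_two]; ring
    rw [h5, Real.rpow_add_one hr.ne']
    have h6 : 0 ≤ T * r₀ ^ (-(2 * κ + 1)) := by positivity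
    calc _ = (C * D + C * N * r) * (r ^ (2 * κ) * r) := by ring
      _ ≤ _ := by
        refine mul_le_mul_of_nonneg_right ?_ (by positivity)
        linarith [mul_le_mul_of_nonneg_left hle (mul_nonneg hC hN0)]
  · refine (setLIntegral_le_lintegral _ _).trans ?_
    rw [← ofReal_integral_norm_eq_lintegral_enorm (integrable_mul_Phi hκ hf)]
    refine ENNReal.ofReal_le_ofReal ?_
    have h1 : r₀ ^ (-(2 * κ + 1)) * r₀ ^ (2 * κ + 1) = 1 := by
      rw [← Real.rpow_add hr₀']; simp
    have h2 : r₀ ^ (2 * κ + 1) ≤ r ^ (2 * κ + 1) :=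
      Real.rpow_le_rpow hr₀'.le hlt.le (by linarith)
    calc T = T * (r₀ ^ (-(2 * κ + 1)) * r₀ ^ (2 * κ + 1)) := by rw [h1, mul_one]
      _ ≤ T * (r₀ ^ (-(2 * κ + 1)) * r ^ (2 * κ + 1)) := by gcongr
      _ = (T * r₀ ^ (-(2 * κ + 1))) * r ^ (2 * κ + 1) := by ring
      _ ≤ _ := by
        gcongr
        have : 0 ≤ C * D + C * N * r₀ := by positivity
        linarith

theorem tau_dil_radial (κ x y : ℝ) (φ₀ : ℝ → ℝ) {ε : ℝ} (hε : 0 < ε) :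
    tau κ x (fun z => dil κ (fun t => ((φ₀ |t| : ℝ) : ℂ)) ε (-z)) y =
      ((ε ^ (-(2 * κ + 1)) : ℝ) : ℂ) *
        ∫ u in Set.Ioo (-1 : ℝ) 1, ((Phi κ u : ℝ) : ℂ) * ((φ₀ (rho x y u / ε) : ℝ) : ℂ) := by
  rw [tau, ← integral_const_mul, ← integral_const_mul]
  congr 1
  ext u
  have h0 : 0 ≤ rho x y u := Real.sqrt_nonneg _
  have h1 : |rho x y u / ε| = rho x y u / ε := abs_of_nonneg (div_nonneg h0 hε.le)
  have h2 : |-rho x y u / ε| = rho x y u / ε := by rw [neg_div, abs_neg, h1]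
  simp only [dil, neg_neg]
  rw [show Real.sqrt (y ^ 2 + x ^ 2 - 2 * x * y * u) = rho x y u from rfl, h1, h2]
  push_cast
  ring

theorem conv_dil_radial {κ x : ℝ} {φ₀ : ℝ → ℝ} {f : ℝ → ℂ} {ε : ℝ} (hε : 0 < ε)
    (hi : Integrable (fun p : ℝ × ℝ => f p.1 * ((Phi κ p.2 : ℝ) : ℂ) *
      ((φ₀ (rho x p.1 p.2 / ε) : ℝ) : ℂ))
      ((mu κ).prod (volume.restrict (Set.Ioo (-1 : ℝ) 1)))) :
    conv κ f (dil κ (fun t => ((φ₀ |t| : ℝ) : ℂ)) ε) x =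
      ((ε ^ (-(2 * κ + 1)) : ℝ) : ℂ) *
        ∫ p : ℝ × ℝ, f p.1 * ((Phi κ p.2 : ℝ) : ℂ) * ((φ₀ (rho x p.1 p.2 / ε) : ℝ) : ℂ)
        ∂((mu κ).prod (volume.restrict (Set.Ioo (-1 : ℝ) 1))) := by
  have : SFinite (mu κ) := by unfold mu; infer_instance
  rw [conv, integral_prod _ hi, ← integral_const_mul]
  congr 1
  ext y
  rw [tau_dil_radial κ x y φ₀ hε, mul_left_comm, ← integral_const_mul]
  simp only [mul_assoc]

/-- almost everywhere summability `(f *_κ φ_ε)(x) → f(x)` a.e. as `ε → 0⁺`. -/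
theorem ae_summability (κ : ℝ) (hκ : 0 < κ) (φ₀ : ℝ → ℝ)
    (hdiff : DifferentiableOn ℝ φ₀ (Set.Ici 0))
    (hlim : Tendsto φ₀ atTop (nhds 0))
    (hint : IntegrableOn (fun r => r ^ (2 * κ + 1) * |deriv φ₀ r|) (Set.Ioi 0))
    (φ : ℝ → ℂ) (hφrad : φ = fun x => ((φ₀ |x| : ℝ) : ℂ))
    (hφ1 : Integrable φ (mu κ)) (hmass : ∫ x, φ x ∂(mu κ) = 1)
    (f : ℝ → ℂ) (hf : Integrable f (mu κ)) :
    ∀ᵐ x ∂(mu κ),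
      Tendsto (fun ε : ℝ => conv κ f (dil κ φ ε) x) (nhdsWithin 0 (Set.Ioi 0))
        (nhds (f x)) := by
  have : SFinite (mu κ) := by unfold mu; infer_instance
  subst hφrad
  rw [integral_radial_mu hκ hdiff hlim hint] at hmass
  filter_upwards [ae_lebesgue_point hκ hf] with x ⟨hx, a, ha, ha0, hfa⟩
  obtain ⟨M, hM⟩ := exists_lintegral_rho_lt_le_rpow hκ hx hf ha hfa
  have hpos : ∀ᵐ p ∂((mu κ).prod (volume.restrict (Set.Ioo (-1 : ℝ) 1))), 0 < rho x p.1 p.2 := by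
    have h1 : ∀ᵐ p ∂((mu κ).prod (volume.restrict (Set.Ioo (-1 : ℝ) 1))),
        p.2 ∈ Set.Ioo (-1 : ℝ) 1 :=
      Measure.quasiMeasurePreserving_snd.ae (ae_restrict_mem measurableSet_Ioo)
    filter_upwards [h1] with p hp using rho_pos hx p.1 hp
  obtain ⟨hi, ht⟩ := tendsto_integral_dilated_radial (integrable_mul_Phi hκ hf).1
    (measurable_rho x) hpos (by linarith) hdiff hlim hint hM
    (tendsto_setIntegral_rho_lt hκ hx hf ha ha0 hfa)
  rw [mul_assoc, hmass, mul_one] at ht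
  refine ht.congr' ?_
  filter_upwards [self_mem_nhdsWithin] with ε hε
  exact (conv_dil_radial hε (hi ε hε)).symm
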